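/- Suppose ℓ(s_i∘w_1) < ℓ(w_1) and ℓ(s_i∘w_2) > ℓ(w_2). Then (1−t)·D_i^{(3)}(Z(w_1,w_2)) = σ_i(Z(s_i∘w_1, w_2)) − t·Z(w_1, s_i∘w_2) in K(z_1,…,z_r). -/

import Mathlib

/-- A spin: `Sum.inl a` is the color `c_{a+1}`, `Sum.inr b` is the dolor `d_{b+1}`
(so indices are 0-based). -/
abbrev Spin (r : ℕ) := Fin r ⊕ Fin r

/-- The `k`-th boson (0-indexed) in the monochrome ordering:
`(c_a, d_b) < (c_{a'}, d_{b'})` iff `b > b'`, or `b = b'` and `a < a'`.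
A boson is recorded as the pair (color index, dolor index), 0-based. -/
def bosonOfIdx {r : ℕ} (k : Fin (r * r)) : Fin r × Fin r :=
  have hr : 0 < r := by
    rcases Nat.eq_zero_or_pos r with h | h
    · exact absurd k.2 (by simp [h])
    · exact h
  (⟨k.val % r, Nat.mod_lt _ hr⟩,
   ⟨r - 1 - k.val / r, lt_of_le_of_lt (Nat.sub_le _ _) (Nat.sub_lt hr one_pos)⟩)

/-- One admissibility step at boson `ab = (a,b)`, from spin `x` to spin `y`,
where `m` is the multiplicity function on the top edge and `m'` on the bottom edge:
either a pass, a split, or a merge. -/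
def StepOK {r : ℕ} (m m' : Fin r × Fin r → ℕ) (ab : Fin r × Fin r)
    (x y : Spin r) : Prop :=
  (y = x ∧ m' ab = m ab) ∨
  (x = Sum.inr ab.2 ∧ y = Sum.inl ab.1 ∧ m ab = m' ab + 1) ∨
  (x = Sum.inl ab.1 ∧ y = Sum.inr ab.2 ∧ m' ab = m ab + 1)

/-- Admissibility of a vertex datum: left spin `l`, top multiplicities `m`,
right spin `rr`, bottom multiplicities `m'`. -/
def AdmissibleVertex {r : ℕ} (l : Spin r) (m : Fin r × Fin r → ℕ) (rr : Spin r)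
    (m' : Fin r × Fin r → ℕ) : Prop :=
  ∃ x : Fin (r * r + 1) → Spin r, x 0 = l ∧ x (Fin.last _) = rr ∧
    ∀ k : Fin (r * r), StepOK m m' (bosonOfIdx k) (x k.castSucc) (x k.succ)

/-- The coefficient ring `ℤ[t][z_1,…,z_r]`, with `t = X none` and `z_{i+1} = X (some i)`. -/
abbrev PolyR (r : ℕ) := MvPolynomial (Option (Fin r)) ℤ

/-- The variable `t`. -/
noncomputable def tP (r : ℕ) : PolyR r := MvPolynomial.X none

/-- The variable `z_{i+1}`. -/
noncomputable def zP {r : ℕ} (i : Fin r) : PolyR r := MvPolynomial.X (some i)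

/-- Weight of a pass step at boson `ab`, where the horizontal spin is `x`,
`n` is the number of bosons on the (equal) vertical edges, and `zi` is the row parameter. -/
noncomputable def passWeight {r : ℕ} (zi : PolyR r) (n : ℕ) (ab : Fin r × Fin r)
    (x : Spin r) : PolyR r :=
  match x with
  | Sum.inl e => if e = ab.1 then zi else if e < ab.1 then tP r ^ n else 1
  | Sum.inr e =>
      if e = ab.2 then 1
      else if ab.1.val = 0 then (if e < ab.2 then tP r ^ n * zi else zi)
      else (if e < ab.2 then tP r ^ n else 1)

/-- Weight of the step at boson `ab` with top multiplicity `m`, bottom multiplicity `m'`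
and incoming horizontal spin `x`. -/
noncomputable def stepWeight {r : ℕ} (zi : PolyR r) (m m' : ℕ) (ab : Fin r × Fin r)
    (x : Spin r) : PolyR r :=
  if m = m' + 1 then ∑ j ∈ Finset.range (min m m' + 1), tP r ^ j
  else if m' = m + 1 then (1 - tP r) * zi
  else passWeight zi (min m m') ab x

/-- The (necessarily unique) next horizontal spin at a boson `ab`. -/
def nextSpin {r : ℕ} (m m' : Fin r × Fin r → ℕ) (ab : Fin r × Fin r) (x : Spin r) : Spin r :=
  if m ab = m' ab + 1 then Sum.inl ab.1
  else if m' ab = m ab + 1 then Sum.inr ab.2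
  else x

/-- The sequence of horizontal spins inside a vertex, starting from the left spin `l`.
For an admissible vertex this coincides with the unique admissibility sequence. -/
def pathSpin {r : ℕ} (m m' : Fin r × Fin r → ℕ) (l : Spin r) : ℕ → Spin r
  | 0 => l
  | k + 1 =>
      if h : k < r * r then nextSpin m m' (bosonOfIdx ⟨k, h⟩) (pathSpin m m' l k)
      else pathSpin m m' l k

/-- Boltzmann weight of an admissible vertex with row parameter `zi`, left spin `l`,
top multiplicities `m` and bottom multiplicities `m'`. -/
noncomputable def vertexWeight {r : ℕ} (zi : PolyR r) (l : Spin r)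
    (m m' : Fin r × Fin r → ℕ) : PolyR r :=
  ∏ k : Fin (r * r),
    stepWeight zi (m (bosonOfIdx k)) (m' (bosonOfIdx k)) (bosonOfIdx k)
      (pathSpin m m' l k.val)

open Classical in
/-- `W(l, m, rr, m')`: the weight of the vertex datum if admissible, and `0` otherwise. -/
noncomputable def Wvert {r : ℕ} (zi : PolyR r) (l : Spin r) (m : Fin r × Fin r → ℕ)
    (rr : Spin r) (m' : Fin r × Fin r → ℕ) : PolyR r :=
  if AdmissibleVertex l m rr m' then vertexWeight zi l m m' else 0

/-- A filling of the `r × N` grid: `m i j` are the boson multiplicities on the vertical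
edge of column `j` between rows `i` and `i+1` (row `0` is the top boundary),
and `h i j` is the horizontal spin of row `i+1` immediately to the right of column `j`
(`j = N` is the left boundary, `j = 0` the right boundary). -/
structure Filling (r N : ℕ) where
  m : Fin (r + 1) → Fin N → Fin r × Fin r → ℕ
  h : Fin r → Fin (N + 1) → Spin r

/-- A state: every vertex is admissible. -/
def Filling.IsState {r N : ℕ} (f : Filling r N) : Prop :=
  ∀ (i : Fin r) (j : Fin N),
    AdmissibleVertex (f.h i j.succ) (f.m i.castSucc j) (f.h i j.castSucc) (f.m i.succ j)

/-- Membership in the system `S(λ; w_1, w_2, w_3, w_4)`. -/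
def InSystem {r N : ℕ} (lam : Fin r → ℕ) (w1 w2 w3 w4 : Equiv.Perm (Fin r))
    (f : Filling r N) : Prop :=
  f.IsState ∧
  (∀ (j : Fin N) (a b : Fin r),
      f.m 0 j (a, b) =
        (Finset.univ.filter fun i : Fin r =>
            lam i = j.val ∧ w3⁻¹ i = a ∧ w4⁻¹ (Fin.rev i) = b).card) ∧
  (∀ (j : Fin N) (ab : Fin r × Fin r), f.m (Fin.last r) j ab = 0) ∧
  (∀ i : Fin r, f.h i 0 = Sum.inl (w1⁻¹ i)) ∧
  (∀ i : Fin r, f.h i (Fin.last N) = Sum.inr (w2⁻¹ i))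

/-- The Boltzmann weight of a state: the product of the weights of its vertices. -/
noncomputable def stateWeight {r N : ℕ} (f : Filling r N) : PolyR r :=
  ∏ i : Fin r, ∏ j : Fin N,
    vertexWeight (zP i) (f.h i j.succ) (f.m i.castSucc j) (f.m i.succ j)

open Classical in
/-- The partition function `Z(λ; w_1, w_2, w_3, w_4)`: the sum of the weights of the
states of the system (a finite sum, expressed via `finsum`). -/
noncomputable def partitionZ (r N : ℕ) (lam : Fin r → ℕ)
    (w1 w2 w3 w4 : Equiv.Perm (Fin r)) : PolyR r :=
  finsum fun f : Filling r N =>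
    if InSystem lam w1 w2 w3 w4 f then stateWeight f else 0

/-- The state `f` has a merge at vertex `(i+1, j)`. -/
def HasMergeAt {r N : ℕ} (f : Filling r N) (i : Fin r) (j : Fin N) : Prop :=
  ∃ ab : Fin r × Fin r, f.m i.castSucc j ab < f.m i.succ j ab

/-- `ℓ(w)`: the number of inversions of a permutation. -/
def invCount {r : ℕ} (w : Equiv.Perm (Fin r)) : ℕ :=
  (Finset.univ.filter fun p : Fin r × Fin r => p.1 < p.2 ∧ w p.2 < w p.1).card

/-- A transposition in `S_r`. -/
def IsTransposition {r : ℕ} (t : Equiv.Perm (Fin r)) : Prop :=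
  ∃ a b : Fin r, a ≠ b ∧ t = Equiv.swap a b

/-- Bruhat order on `S_r`. -/
def bruhatLE {r : ℕ} (u v : Equiv.Perm (Fin r)) : Prop :=
  Relation.ReflTransGen
    (fun x y => ∃ t, IsTransposition t ∧ y = x * t ∧ invCount x < invCount y) u v

/-- The field `K = ℚ(t)`. -/
abbrev Kt := RatFunc ℚ

/-- The field `K(z_1,…,z_r)` of rational functions over `K = ℚ(t)`. -/
abbrev FFld (r : ℕ) := FractionRing (MvPolynomial (Fin r) Kt)

/-- The variable `z_{i+1}` in `K(z_1,…,z_r)`. -/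
noncomputable def zF {r : ℕ} (i : Fin r) : FFld r :=
  algebraMap (MvPolynomial (Fin r) Kt) (FFld r) (MvPolynomial.X i)

/-- The element `t` in `K(z_1,…,z_r)`. -/
noncomputable def tF (r : ℕ) : FFld r :=
  algebraMap (MvPolynomial (Fin r) Kt) (FFld r) (MvPolynomial.C RatFunc.X)

/-- The canonical ring homomorphism `ℤ[t][z_1,…,z_r] → K(z_1,…,z_r)`. -/
noncomputable def toFF (r : ℕ) : PolyR r →+* FFld r :=
  MvPolynomial.eval₂Hom (Int.castRingHom (FFld r)) fun o => o.elim (tF r) zF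

/-- The K-algebra automorphism `σ` of `K(z_1,…,z_r)` exchanging `z_a` and `z_b` and
fixing the other variables. -/
noncomputable def sigmaF {r : ℕ} (a b : Fin r) : FFld r ≃+* FFld r :=
  IsFractionRing.ringEquivOfRingEquiv
    (MvPolynomial.renameEquiv Kt (Equiv.swap a b)).toRingEquiv

/-- `D^{(1)} f = (z_a - z_b)⁻¹ (z_a f - z_a σ(f))`. -/
noncomputable def DF1 {r : ℕ} (a b : Fin r) (f : FFld r) : FFld r :=
  (zF a - zF b)⁻¹ * (zF a * f - zF a * sigmaF a b f)

/-- `D^{(2)} f = (z_a - z_b)⁻¹ (z_a f - z_b σ(f))`. -/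
noncomputable def DF2 {r : ℕ} (a b : Fin r) (f : FFld r) : FFld r :=
  (zF a - zF b)⁻¹ * (zF a * f - zF b * sigmaF a b f)

/-- `D^{(3)} f = (z_a - z_b)⁻¹ (z_b f - z_a σ(f))`. -/
noncomputable def DF3 {r : ℕ} (a b : Fin r) (f : FFld r) : FFld r :=
  (zF a - zF b)⁻¹ * (zF b * f - zF a * sigmaF a b f)

/-- `D^{(4)} f = (z_a - z_b)⁻¹ (z_b f - z_b σ(f))`. -/
noncomputable def DF4 {r : ℕ} (a b : Fin r) (f : FFld r) : FFld r :=
  (zF a - zF b)⁻¹ * (zF b * f - zF b * sigmaF a b f)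



section YBLocal
variable {F S : Type*} [Field F] [DecidableEq S]

/-- monochrome weight -/
def wt (t : F) (α β : S) (τ d : S → Bool) (z Q : F) (x y : S) : F :=
  if x = y then
    (if x = α then 1 else if x = β then z
      else (if τ x then Q else 1) * (if d x then z else 1))
  else if x = α ∧ y = β then (1 - Q) / (1 - t)
  else if x = β ∧ y = α then (1 - t) * z
  else 0

def ind (α x : S) : ℤ := if x = α then 1 else 0

structure YBData (t z1 z2 : F) (α β : S) (τ d : S → Bool) (A A' B : S → S → F) : Prop where
  hne : α ≠ β
  hA : ∀ p, A p p = z1 - t * z2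
  hA' : ∀ p, A' p p = z1 - t * z2
  hB : ∀ p, B p p = 0
  a1 : A α β = (1 - t) * z1
  a2 : A' α β = (1 - t) * z1
  a3 : A β α = (1 - t) * z2
  a4 : A' β α = (1 - t) * z2
  b1 : B α β = z1 - z2
  b2 : B β α = t * (z1 - z2)
  g1 : ∀ g, g ≠ α → g ≠ β → A α g * (if d g then z2 else 1) = (if d g then z1 else 1) * A' α g
  g2 : ∀ g, g ≠ α → g ≠ β → A' β g = A' α g
  g3 : ∀ g, g ≠ α → g ≠ β → A β g * z1 = A α g * z2
  g4 : ∀ g, g ≠ α → g ≠ β → A g α * (if d g then z1 else 1) = (if d g then z2 else 1) * A' g α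
  g5 : ∀ g, g ≠ α → g ≠ β → A' g β = A' g α
  g6 : ∀ g, g ≠ α → g ≠ β → A g β * z2 = A g α * z1
  g7 : ∀ g, g ≠ α → g ≠ β → B β g = (if τ g then t else 1) * B α g
  g8 : ∀ g, g ≠ α → g ≠ β → B g α = (if τ g then t else 1) * B g β
  k1 : ∀ g h, g ≠ α → g ≠ β → h ≠ α → h ≠ β → g ≠ h →
    A g h * (if d g then z1 else 1) * (if d h then z2 else 1) =
     (if d g then z2 else 1) * (if d h then z1 else 1) * A' g h

def WW (t : F) (α β : S) (τ d : S → Bool) (z1 z2 Q : F) (x1 x2 y1 y2 : S) : F :=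
  wt t α β τ d z1 Q x1 y1 * wt t α β τ d z2 (Q * t ^ (ind α y1 - ind α x1)) x2 y2

set_option maxHeartbeats 4000000 in
set_option linter.unusedSimpArgs false in
theorem localYB {t z1 z2 : F} {α β : S} {τ d : S → Bool} {A A' B : S → S → F}
    (ht : t ≠ 0) (ht1 : 1 - t ≠ 0) (hz1 : z1 ≠ 0) (hz2 : z2 ≠ 0)
    (H : YBData t z1 z2 α β τ d A A' B) (Q : F) (x1 x2 y1 y2 : S) :
    A x1 x2 * WW t α β τ d z1 z2 Q x1 x2 y1 y2 + B x1 x2 * WW t α β τ d z1 z2 Q x2 x1 y1 y2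
    = WW t α β τ d z2 z1 Q x1 x2 y1 y2 * A' y1 y2
      + WW t α β τ d z2 z1 Q x1 x2 y2 y1 * B y2 y1 := by
  obtain ⟨hne, hA, hA', hB, a1, a2, a3, a4, b1, b2, g1, g2, g3, g4, g5, g6, g7, g8, k1⟩ := H
  have hne' := hne.symm
  have tri : ∀ x : S, x = α ∨ x = β ∨ (x ≠ α ∧ x ≠ β) := by
    intro x; by_cases h : x = α
    · exact Or.inl h
    · by_cases h' : x = β
      · exact Or.inr (Or.inl h')
      · exact Or.inr (Or.inr ⟨h, h'⟩)
  have tm : t ^ (-1 : ℤ) = t⁻¹ := by simp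
  rcases tri x1 with h1 | h1 | ⟨h1, h1'⟩ <;> rcases tri x2 with h2 | h2 | ⟨h2, h2'⟩
  · subst h1; subst h2
    rcases tri y1 with h3 | h3 | ⟨h3, h3'⟩ <;> rcases tri y2 with h4 | h4 | ⟨h4, h4'⟩ <;>
      simp [WW, wt, ind, h3, h4, *, Ne.symm] <;> grind
  · subst h1; subst h2
    rcases tri y1 with h3 | h3 | ⟨h3, h3'⟩ <;> rcases tri y2 with h4 | h4 | ⟨h4, h4'⟩ <;>
      simp [WW, wt, ind, h3, h4, *, Ne.symm] <;> grind
  · subst h1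
    specialize g1 _ h2 h2'
    specialize g2 _ h2 h2'
    specialize g3 _ h2 h2'
    specialize g4 _ h2 h2'
    specialize g5 _ h2 h2'
    specialize g6 _ h2 h2'
    specialize g7 _ h2 h2'
    specialize g8 _ h2 h2'
    clear k1
    have k := h2.symm
    have k' := h2'.symm
    by_cases e3 : y1 = x2
    · subst e3
      rcases tri y2 with h4 | h4 | ⟨h4, h4'⟩
      · simp [WW, wt, ind, h4, k, k', h2, h2', hne, hne']; grind
      · simp [WW, wt, ind, h4, k, k', h2, h2', hne, hne']; grind
      · simp [WW, wt, ind, h4, h4', h4.symm, h4'.symm, k, k', h2, h2', hne, hne']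
    · by_cases e4 : y2 = x2
      · subst e4
        rcases tri y1 with h4 | h4 | ⟨h4, h4'⟩
        · simp [WW, wt, ind, h4, k, k', h2, h2', hne, hne']; grind
        · simp [WW, wt, ind, h4, k, k', h2, h2', hne, hne']; grind
        · simp [WW, wt, ind, h4, h4', h4.symm, h4'.symm, k, k', h2, h2', hne, hne']
      · have e3' := Ne.symm e3
        have e4' := Ne.symm e4
        simp [WW, wt, e3', e4', h2, h2']
  · subst h1; subst h2
    rcases tri y1 with h3 | h3 | ⟨h3, h3'⟩ <;> rcases tri y2 with h4 | h4 | ⟨h4, h4'⟩ <;>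
      simp [WW, wt, ind, h3, h4, *, Ne.symm] <;> grind
  · subst h1; subst h2
    rcases tri y1 with h3 | h3 | ⟨h3, h3'⟩ <;> rcases tri y2 with h4 | h4 | ⟨h4, h4'⟩ <;>
      simp [WW, wt, ind, h3, h4, *, Ne.symm] <;> grind
  · subst h1
    specialize g1 _ h2 h2'
    specialize g2 _ h2 h2'
    specialize g3 _ h2 h2'
    specialize g4 _ h2 h2'
    specialize g5 _ h2 h2'
    specialize g6 _ h2 h2'
    specialize g7 _ h2 h2'
    specialize g8 _ h2 h2'
    clear k1
    have k := h2.symm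
    have k' := h2'.symm
    by_cases e3 : y1 = x2
    · subst e3
      rcases tri y2 with h4 | h4 | ⟨h4, h4'⟩
      · simp [WW, wt, ind, h4, k, k', h2, h2', hne, hne']; grind
      · simp [WW, wt, ind, h4, k, k', h2, h2', hne, hne']; grind
      · simp [WW, wt, ind, h4, h4', h4.symm, h4'.symm, k, k', h2, h2', hne, hne']
    · by_cases e4 : y2 = x2
      · subst e4
        rcases tri y1 with h4 | h4 | ⟨h4, h4'⟩
        · simp [WW, wt, ind, h4, k, k', h2, h2', hne, hne']; grind
        · simp [WW, wt, ind, h4, k, k', h2, h2', hne, hne']; grind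
        · simp [WW, wt, ind, h4, h4', h4.symm, h4'.symm, k, k', h2, h2', hne, hne']
      · have e3' := Ne.symm e3
        have e4' := Ne.symm e4
        simp [WW, wt, e3', e4', h2, h2']
  · subst h2
    specialize g1 _ h1 h1'
    specialize g2 _ h1 h1'
    specialize g3 _ h1 h1'
    specialize g4 _ h1 h1'
    specialize g5 _ h1 h1'
    specialize g6 _ h1 h1'
    specialize g7 _ h1 h1'
    specialize g8 _ h1 h1'
    clear k1
    have k := h1.symm
    have k' := h1'.symm
    by_cases e3 : y1 = x1
    · subst e3
      rcases tri y2 with h4 | h4 | ⟨h4, h4'⟩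
      · simp [WW, wt, ind, h4, k, k', h1, h1', hne, hne']; grind
      · simp [WW, wt, ind, h4, k, k', h1, h1', hne, hne']; grind
      · simp [WW, wt, ind, h4, h4', h4.symm, h4'.symm, k, k', h1, h1', hne, hne']
    · by_cases e4 : y2 = x1
      · subst e4
        rcases tri y1 with h4 | h4 | ⟨h4, h4'⟩
        · simp [WW, wt, ind, h4, k, k', h1, h1', hne, hne']; grind
        · simp [WW, wt, ind, h4, k, k', h1, h1', hne, hne']; grind
        · simp [WW, wt, ind, h4, h4', h4.symm, h4'.symm, k, k', h1, h1', hne, hne']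
      · have e3' := Ne.symm e3
        have e4' := Ne.symm e4
        simp [WW, wt, e3', e4', h1, h1']
  · subst h2
    specialize g1 _ h1 h1'
    specialize g2 _ h1 h1'
    specialize g3 _ h1 h1'
    specialize g4 _ h1 h1'
    specialize g5 _ h1 h1'
    specialize g6 _ h1 h1'
    specialize g7 _ h1 h1'
    specialize g8 _ h1 h1'
    clear k1
    have k := h1.symm
    have k' := h1'.symm
    by_cases e3 : y1 = x1
    · subst e3
      rcases tri y2 with h4 | h4 | ⟨h4, h4'⟩
      · simp [WW, wt, ind, h4, k, k', h1, h1', hne, hne']; grind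
      · simp [WW, wt, ind, h4, k, k', h1, h1', hne, hne']; grind
      · simp [WW, wt, ind, h4, h4', h4.symm, h4'.symm, k, k', h1, h1', hne, hne']
    · by_cases e4 : y2 = x1
      · subst e4
        rcases tri y1 with h4 | h4 | ⟨h4, h4'⟩
        · simp [WW, wt, ind, h4, k, k', h1, h1', hne, hne']; grind
        · simp [WW, wt, ind, h4, k, k', h1, h1', hne, hne']; grind
        · simp [WW, wt, ind, h4, h4', h4.symm, h4'.symm, k, k', h1, h1', hne, hne']
      · have e3' := Ne.symm e3
        have e4' := Ne.symm e4
        simp [WW, wt, e3', e4', h1, h1']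
  · clear g1 g2 g3 g4 g5 g6 g7 g8
    by_cases e : x1 = x2
    · subst e
      by_cases e3 : y1 = x1 <;> by_cases e4 : y2 = x1 <;>
        simp [WW, wt, ind, Ne.symm, *] <;> grind
    · specialize k1 _ _ h1 h1' h2 h2' e
      by_cases e3 : y1 = x1 <;> by_cases e4 : y2 = x1 <;>
      by_cases e5 : y1 = x2 <;> by_cases e6 : y2 = x2 <;>
        simp [WW, wt, ind, Ne.symm, *] <;> grind

end YBLocal


section YBColumn
variable {F S : Type*} [Field F] [DecidableEq S] {r : ℕ}

def colM (m0 : ℤ) (α : S) (x y : Fin r → S) (i : ℕ) : ℤ :=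
  m0 + ∑ j : Fin r, if j.val < i then ind α (y j) - ind α (x j) else 0

/-- weight of a monochrome column -/
def colW (t : F) (α β : S) (τ d : S → Bool) (m0 : ℕ) (z : Fin r → F) (x y : Fin r → S) : F :=
  if colM m0 α x y r = 0 then
    ∏ i : Fin r, wt t α β τ d (z i) (t ^ colM m0 α x y i) (x i) (y i)
  else 0

theorem prod_two {M : Type*} [CommMonoid M] (f : Fin r → M) {a b : Fin r} (hab : a ≠ b) :
    ∏ i, f i = (f a * f b) * ∏ i ∈ (Finset.univ.erase a).erase b, f i := by
  rw [← Finset.mul_prod_erase Finset.univ f (Finset.mem_univ a),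
    ← Finset.mul_prod_erase (Finset.univ.erase a) f (a := b) (by simp [hab.symm]), mul_assoc]

theorem sum_two {M : Type*} [AddCommMonoid M] (f : Fin r → M) {a b : Fin r} (hab : a ≠ b) :
    ∑ i, f i = (f a + f b) + ∑ i ∈ (Finset.univ.erase a).erase b, f i := by
  rw [← Finset.add_sum_erase Finset.univ f (Finset.mem_univ a),
    ← Finset.add_sum_erase (Finset.univ.erase a) f (a := b) (by simp [hab.symm]), add_assoc]

theorem colM_congr (m0 : ℤ) (α : S) (x y x' y' : Fin r → S) {a b : Fin r} (hab : a.val + 1 = b.val)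
    (hx : ∀ j, j ≠ a → j ≠ b → x' j = x j) (hy : ∀ j, j ≠ a → j ≠ b → y' j = y j)
    (hsx : ind α (x' a) + ind α (x' b) = ind α (x a) + ind α (x b))
    (hsy : ind α (y' a) + ind α (y' b) = ind α (y a) + ind α (y b))
    (i : ℕ) (hi : i ≠ b.val) : colM m0 α x' y' i = colM m0 α x y i := by
  have hne : a ≠ b := by intro h; rw [h] at hab; omega
  unfold colM
  rw [sum_two _ hne, sum_two _ hne]
  congr 2
  · by_cases h : a.val < i
    · have : b.val < i := by omega
      simp only [h, this, if_true]; linarith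
    · have : ¬ b.val < i := by omega
      simp only [h, this, if_false]
  · apply Finset.sum_congr rfl
    intro j hj
    simp at hj
    rw [hx j hj.2 hj.1, hy j hj.2 hj.1]

theorem colM_succ (m0 : ℤ) (α : S) (x y : Fin r → S) (a : Fin r) :
    colM m0 α x y (a.val + 1) = colM m0 α x y a.val + (ind α (y a) - ind α (x a)) := by
  unfold colM
  rw [add_assoc]
  congr 1
  rw [← Finset.add_sum_erase Finset.univ _ (Finset.mem_univ a),
    ← Finset.add_sum_erase (s := Finset.univ) (a := a)
      (f := fun j : Fin r => if j.val < a.val then ind α (y j) - ind α (x j) else 0) (Finset.mem_univ a)]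
  simp only [lt_add_iff_pos_right, zero_lt_one, if_true, lt_irrefl, if_false, zero_add]
  rw [add_comm]
  congr 1
  apply Finset.sum_congr rfl
  intro j hj
  have : j.val ≠ a.val := fun h => (Finset.mem_erase.1 hj).1 (Fin.ext h)
  have e : (j.val < a.val + 1) = (j.val < a.val) := by
    apply propext; omega
  simp only [e]

theorem colW_split {t : F} (ht : t ≠ 0) {α β : S} {τ d : S → Bool} {m0 : ℕ} (z z' : Fin r → F)
    (x y x' y' : Fin r → S) {a b : Fin r} (hab : a.val + 1 = b.val)
    (hz : ∀ j, j ≠ a → j ≠ b → z' j = z j)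
    (hx : ∀ j, j ≠ a → j ≠ b → x' j = x j) (hy : ∀ j, j ≠ a → j ≠ b → y' j = y j)
    (hsx : ind α (x' a) + ind α (x' b) = ind α (x a) + ind α (x b))
    (hsy : ind α (y' a) + ind α (y' b) = ind α (y a) + ind α (y b)) :
    colW t α β τ d m0 z' x' y' =
    (if colM m0 α x y r = 0 then ∏ i ∈ (Finset.univ.erase a).erase b,
      wt t α β τ d (z i) (t ^ colM m0 α x y i) (x i) (y i) else 0) *
      WW t α β τ d (z' a) (z' b) (t ^ colM m0 α x y a) (x' a) (x' b) (y' a) (y' b) := by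
  have hne : a ≠ b := by intro h; rw [h] at hab; omega
  have hc := colM_congr (m0 : ℤ) α x y x' y' hab hx hy hsx hsy
  unfold colW
  rw [hc r b.2.ne', prod_two _ hne, ← hab, colM_succ, hc a (by omega), zpow_add₀ ht]
  rw [ite_mul, zero_mul]
  congr 1
  rw [mul_comm]
  congr 1
  apply Finset.prod_congr rfl
  intro j hj
  simp at hj
  have : j.val ≠ b.val := fun h => hj.1 (Fin.ext h)
  rw [hx j hj.2 hj.1, hy j hj.2 hj.1, hz j hj.2 hj.1, hc j this]

open Matrix in
/-- R-matrix acting in slots a, b -/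
def Rmat [Fintype S] (a b : Fin r) (A B : S → S → F) : Matrix (Fin r → S) (Fin r → S) F :=
  fun x u => (if u = x then A (x a) (x b) else 0) +
    (if u = x ∘ Equiv.swap a b then B (x a) (x b) else 0)

theorem Rmat_mul [Fintype S] (a b : Fin r) (A B : S → S → F)
    (C : Matrix (Fin r → S) (Fin r → S) F) (x y : Fin r → S) :
    (Rmat a b A B * C) x y = A (x a) (x b) * C x y + B (x a) (x b) * C (x ∘ Equiv.swap a b) y := by
  simp [Matrix.mul_apply, Rmat, add_mul, Finset.sum_add_distrib]

theorem mul_Rmat [Fintype S] (a b : Fin r) (A B : S → S → F)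
    (C : Matrix (Fin r → S) (Fin r → S) F) (x y : Fin r → S) :
    (C * Rmat a b A B) x y = C x y * A (y a) (y b) + C x (y ∘ Equiv.swap a b) * B (y b) (y a) := by
  have h : ∀ v : Fin r → S, (y = v ∘ Equiv.swap a b) = (v = y ∘ Equiv.swap a b) := by
    intro v
    apply propext
    constructor
    · intro h; subst h; ext i; simp
    · intro h; subst h; ext i; simp
  simp [Matrix.mul_apply, Rmat, mul_add, Finset.sum_add_distrib, h]

theorem colYB [Fintype S] {t : F} {α β : S} {τ d : S → Bool} {A A' B : S → S → F} (z : Fin r → F)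
    {a b : Fin r} (hab : a.val + 1 = b.val) (ht : t ≠ 0) (ht1 : 1 - t ≠ 0)
    (hz1 : z a ≠ 0) (hz2 : z b ≠ 0)
    (H : YBData t (z a) (z b) α β τ d A A' B) (m0 : ℕ) :
    Rmat a b A B * (Matrix.of (colW t α β τ d m0 z)) =
      (Matrix.of (colW t α β τ d m0 (z ∘ Equiv.swap a b))) * Rmat a b A' B := by
  have sw : ∀ {T : Type _} (x : Fin r → T) (j : Fin r), j ≠ a → j ≠ b →
      (x ∘ Equiv.swap a b) j = x j := by
    intro T x j h h'
    simp [Equiv.swap_apply_of_ne_of_ne h h']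
  have sw2 : ∀ (x : Fin r → F) (j : Fin r), j ≠ a → j ≠ b →
      (x ∘ Equiv.swap a b) j = x j := by
    intro x j h h'
    simp [Equiv.swap_apply_of_ne_of_ne h h']
  ext x y
  rw [Rmat_mul, mul_Rmat]
  simp only [Matrix.of_apply]
  rw [colW_split ht z z x y x y hab (by simp) (by simp) (by simp) rfl rfl,
    colW_split ht z z x y (x ∘ Equiv.swap a b) y hab (by simp) (sw x) (by simp)
      (by simp [add_comm]) rfl,
    colW_split ht z (z ∘ Equiv.swap a b) x y x y hab (sw2 z) (by simp) (by simp) rfl rfl,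
    colW_split ht z (z ∘ Equiv.swap a b) x y x (y ∘ Equiv.swap a b) hab (sw2 z) (by simp) (sw y)
      rfl (by simp [add_comm])]
  have := localYB ht ht1 hz1 hz2 H (t ^ colM m0 α x y a) (x a) (x b) (y a) (y b)
  simp only [Function.comp_apply, Equiv.swap_apply_left, Equiv.swap_apply_right]
  linear_combination (if colM m0 α x y r = 0 then ∏ i ∈ (Finset.univ.erase a).erase b,
      wt t α β τ d (z i) (t ^ colM m0 α x y i) (x i) (y i) else 0) * this

end YBColumn


section Concrete
variable {F : Type*} [Field F] {r : ℕ}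

def expo (a b : ℤ) : Spin r → Spin r → ℤ
  | Sum.inl p, Sum.inl q => (if q < p then 1 else 0) + (if (p.val : ℤ) < a then 1 else 0)
      - (if (q.val : ℤ) < a then 1 else 0)
  | Sum.inr p, Sum.inr q => (if q < p then 1 else 0) - (if b < (p.val : ℤ) then 1 else 0)
      + (if b < (q.val : ℤ) then 1 else 0)
      + (if 0 < a then ((if (q.val : ℤ) = b then 1 else 0) - (if (p.val : ℤ) = b then 1 else 0)) else 0)
  | Sum.inr e, Sum.inl f => 1 + (if (e.val : ℤ) = b then 0 else
      ((if 0 < a then 1 else 0) - (if (f.val : ℤ) < a then 1 else 0)))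
  | Sum.inl f, Sum.inr e => - (if (e.val : ℤ) = b then 0 else
      ((if 0 < a then 1 else 0) - (if (f.val : ℤ) < a then 1 else 0)))

def Aval (t z1 z2 : F) (e : ℤ) : F := (1 - t) * (z1 ^ e * z2 ^ (1 - e))

def Afun (t z1 z2 : F) (a b : ℤ) (x y : Spin r) : F :=
  if x = y then z1 - t * z2 else Aval t z1 z2 (expo a b x y)

def Bc (t : F) : Spin r → Spin r → F
  | Sum.inl p, Sum.inl q => if p < q then 1 else t
  | Sum.inr p, Sum.inr q => if p < q then t else 1
  | Sum.inr _, Sum.inl _ => 1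
  | Sum.inl _, Sum.inr _ => t

def Bfun (t z1 z2 : F) (x y : Spin r) : F := if x = y then 0 else Bc t x y * (z1 - z2)

def tauB (ab : Fin r × Fin r) : Spin r → Bool
  | Sum.inl e => decide (e < ab.1)
  | Sum.inr e => decide (e < ab.2)

def degB (ab : Fin r × Fin r) : Spin r → Bool
  | Sum.inl _ => false
  | Sum.inr _ => decide (ab.1.val = 0)

theorem Aval_zero (t z1 z2 : F) : Aval t z1 z2 0 = (1 - t) * z2 := by simp [Aval]
theorem Aval_one (t z1 z2 : F) : Aval t z1 z2 1 = (1 - t) * z1 := by simp [Aval]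

theorem Aval_succ (t : F) {z1 z2 : F} (h1 : z1 ≠ 0) (h2 : z2 ≠ 0) (e : ℤ) :
    Aval t z1 z2 (e + 1) * z2 = Aval t z1 z2 e * z1 := by
  unfold Aval
  rw [zpow_add₀ h1, show (1 - e : ℤ) = (1 - (e + 1)) + 1 by ring, zpow_add₀ h2 (1 - (e+1))]
  simp; ring

theorem concreteYB {t z1 z2 : F} (h1 : z1 ≠ 0) (h2 : z2 ≠ 0) (ab : Fin r × Fin r) :
    YBData t z1 z2 (Sum.inr ab.2 : Spin r) (Sum.inl ab.1) (tauB ab) (degB ab)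
      (Afun t z1 z2 ab.1.val ab.2.val) (Afun t z1 z2 (ab.1.val + 1) ab.2.val) (Bfun t z1 z2) := by
  obtain ⟨a, b⟩ := ab
  have S := Aval_succ t h1 h2
  have key : ∀ (g g' : Bool) (e e' : ℤ),
      e + (if g then 1 else 0) = e' + (if g' then 1 else 0) →
      Aval t z1 z2 e * (if g then z1 else 1) * (if g' then z2 else 1) =
      (if g then z2 else 1) * (if g' then z1 else 1) * Aval t z1 z2 e' := by
    intro g g' e e' h
    cases g <;> cases g' <;> simp at h ⊢
    · rw [h]
    · rw [h, S]; ring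
    · rw [← h, ← S]; ring
    · rw [h]; ring
  constructor
  · simp
  · simp [Afun]
  · simp [Afun]
  · simp [Bfun]
  · simp [Afun, expo, Aval_one]
  · simp [Afun, expo, Aval_one]
  · simp [Afun, expo, Aval_zero]
  · simp [Afun, expo, Aval_zero]
  · simp [Bfun, Bc]
  · simp [Bfun, Bc]
  · rintro (g | g) hg hg'
    · have := key false (degB (a, b) (Sum.inl g)) (e' := expo (a.val + 1) b.val (Sum.inr b) (Sum.inl g))
        (e := expo (a.val) b.val (Sum.inr b) (Sum.inl g)) ?_
      · simpa [Afun] using this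
      · simp [expo, degB]
    · have hb : b ≠ g := fun h => hg (by rw [h])
      have hb' : g.val ≠ b.val := fun h => hb (Fin.ext h.symm)
      have := key false (degB (a, b) (Sum.inr g)) (e' := expo (a.val + 1) b.val (Sum.inr b) (Sum.inr g))
        (e := expo (a.val) b.val (Sum.inr b) (Sum.inr g)) ?_
      · simpa [Afun, hb] using this
      · simp [expo, degB, hb, hb']; split_ifs <;> omega
  · rintro (g | g) hg hg'
    · have hb : a ≠ g := fun h => hg' (by rw [h])
      have hb' : g.val ≠ a.val := fun h => hb (Fin.ext h.symm)
      have : expo (a.val + 1) b.val (Sum.inl a) (Sum.inl g) = expo (a.val + 1) b.val (Sum.inr b) (Sum.inl g) := by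
        simp [expo]; split_ifs <;> omega
      simp [Afun, hb, this]
    · have hb : b ≠ g := fun h => hg (by rw [h])
      have hb' : g.val ≠ b.val := fun h => hb (Fin.ext h.symm)
      have : expo (a.val + 1) b.val (Sum.inl a) (Sum.inr g) = expo (a.val + 1) b.val (Sum.inr b) (Sum.inr g) := by
        simp [expo]; split_ifs <;> omega
      simp [Afun, hb, this]
  · rintro (g | g) hg hg'
    · have hb : a ≠ g := fun h => hg' (by rw [h])
      have hb' : g.val ≠ a.val := fun h => hb (Fin.ext h.symm)
      have : expo (a.val) b.val (Sum.inr b) (Sum.inl g) = expo (a.val) b.val (Sum.inl a) (Sum.inl g) + 1 := by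
        simp [expo] <;> (try split_ifs) <;> omega
      simp [Afun, hb, this, S]
    · have hb : b ≠ g := fun h => hg (by rw [h])
      have hb' : g.val ≠ b.val := fun h => hb (Fin.ext h.symm)
      have : expo (a.val) b.val (Sum.inr b) (Sum.inr g) = expo (a.val) b.val (Sum.inl a) (Sum.inr g) + 1 := by
        simp [expo] <;> (try split_ifs) <;> omega
      simp [Afun, hb, this, S]
  · rintro (g | g) hg hg'
    · have := key (degB (a, b) (Sum.inl g)) false (e' := expo (a.val + 1) b.val (Sum.inl g) (Sum.inr b))
        (e := expo (a.val) b.val (Sum.inl g) (Sum.inr b)) ?_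
      · simpa [Afun] using this
      · simp [expo, degB]
    · have hb : g ≠ b := fun h => hg (by rw [h])
      have hb' : g.val ≠ b.val := fun h => hb (Fin.ext h)
      have := key (degB (a, b) (Sum.inr g)) false (e' := expo (a.val + 1) b.val (Sum.inr g) (Sum.inr b))
        (e := expo (a.val) b.val (Sum.inr g) (Sum.inr b)) ?_
      · simpa [Afun, hb] using this
      · simp [expo, degB, hb, hb']; split_ifs <;> omega
  · rintro (g | g) hg hg'
    · have hb : g ≠ a := fun h => hg' (by rw [h])
      have hb' : g.val ≠ a.val := fun h => hb (Fin.ext h)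
      have : expo (a.val + 1) b.val (Sum.inl g) (Sum.inl a) = expo (a.val + 1) b.val (Sum.inl g) (Sum.inr b) := by
        simp [expo]; split_ifs <;> omega
      simp [Afun, hb, this]
    · have hb : g ≠ b := fun h => hg (by rw [h])
      have hb' : g.val ≠ b.val := fun h => hb (Fin.ext h)
      have : expo (a.val + 1) b.val (Sum.inr g) (Sum.inl a) = expo (a.val + 1) b.val (Sum.inr g) (Sum.inr b) := by
        simp [expo]; split_ifs <;> omega
      simp [Afun, hb, this]
  · rintro (g | g) hg hg'
    · have hb : g ≠ a := fun h => hg' (by rw [h])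
      have hb' : g.val ≠ a.val := fun h => hb (Fin.ext h)
      have : expo (a.val) b.val (Sum.inl g) (Sum.inl a) = expo (a.val) b.val (Sum.inl g) (Sum.inr b) + 1 := by
        simp [expo] <;> (try split_ifs) <;> omega
      simp [Afun, hb, this, S]
    · have hb : g ≠ b := fun h => hg (by rw [h])
      have hb' : g.val ≠ b.val := fun h => hb (Fin.ext h)
      have : expo (a.val) b.val (Sum.inr g) (Sum.inl a) = expo (a.val) b.val (Sum.inr g) (Sum.inr b) + 1 := by
        simp [expo] <;> (try split_ifs) <;> omega
      simp [Afun, hb, this, S]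
  · rintro (g | g) hg hg'
    · have hb : a ≠ g := fun h => hg' (by rw [h])
      simp [Bfun, Bc, tauB, hb]; split_ifs <;> first | omega | simp
    · have hb : b ≠ g := fun h => hg (by rw [h])
      simp [Bfun, Bc, tauB, hb]; split_ifs <;> first | omega | simp
  · rintro (g | g) hg hg'
    · have hb : g ≠ a := fun h => hg' (by rw [h])
      simp [Bfun, Bc, tauB, hb] <;> split_ifs <;> rfl
    · have hb : g ≠ b := fun h => hg (by rw [h])
      simp [Bfun, Bc, tauB, hb]
  · rintro (g | g) (h | h) hg hg' hh hh' hgh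
    all_goals
      simp only [ne_eq, Sum.inl.injEq, Sum.inr.injEq, reduceCtorEq, not_false_eq_true] at hg hg' hh hh' hgh
      simp only [Afun, Sum.inl.injEq, Sum.inr.injEq, reduceCtorEq, if_false, hgh]
      apply key
      simp [expo, degB]
      try split_ifs
      all_goals omega

end Concrete


section Chain
variable {F : Type*} [Field F] {r : ℕ}

def Qprod {X : Type*} [Fintype X] [DecidableEq X] (M : ℕ → Matrix X X F) : ℕ → Matrix X X F
  | 0 => 1
  | n + 1 => Qprod M n * M n

theorem Qprod_apply {X : Type*} [Fintype X] [DecidableEq X] (M : ℕ → Matrix X X F) (n : ℕ) (x y : X) :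
    Qprod M n x y = ∑ h : Fin (n + 1) → X, if h 0 = x ∧ h (Fin.last n) = y then
      ∏ k : Fin n, M k (h k.castSucc) (h k.succ) else 0 := by
  induction n generalizing y with
  | zero =>
    rw [← (Equiv.funUnique (Fin 1) X).symm.sum_comp]
    simp [Qprod, Matrix.one_apply]
    by_cases h : x = y
    · subst h; simp [Finset.filter_eq']
    · simp only [h, if_false]
      rw [Finset.filter_false_of_mem]
      · simp
      · rintro u _ ⟨h1, h2⟩
        exact h (h1.symm.trans h2)
  | succ n ih =>
    rw [← (Fin.snocEquiv (fun _ : Fin (n + 2) => X)).sum_comp, Fintype.sum_prod_type]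
    simp only [Qprod, Matrix.mul_apply, ih, Fin.snocEquiv_apply]
    rw [Finset.sum_comm' (t' := Finset.univ) (s' := fun _ => Finset.univ) (by simp)]
    simp only [Finset.sum_mul]
    rw [Finset.sum_comm]
    apply Finset.sum_congr rfl
    intro h _
    have e : ∀ v : X, (Fin.snoc h v : Fin (n + 2) → X) 0 = h 0 := by
      intro v
      exact Fin.snoc_castSucc (α := fun _ => X) v h 0
    have e2 : ∀ (v : X) (k : Fin n), (Fin.snoc h v : Fin (n + 2) → X) k.castSucc.succ = h k.succ := by
      intro v k
      rw [Fin.succ_castSucc]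
      exact Fin.snoc_castSucc (α := fun _ => X) v h k.succ
    simp only [e, e2, Fin.snoc_last, Fin.prod_univ_castSucc, Fin.snoc_castSucc, Fin.succ_last,
      Fin.val_castSucc, Fin.val_last]
    by_cases hx : h 0 = x
    · simp [hx]
    · simp [hx]

variable (t : F)

/-- matrix of the k-th monochrome column -/
def Cmat (top : Fin r × Fin r → ℕ) (z : Fin r → F) (k : ℕ) :
    Matrix (Fin r → Spin r) (Fin r → Spin r) F :=
  if h : k < r * r then
    Matrix.of (colW t (Sum.inr (bosonOfIdx ⟨k, h⟩).2 : Spin r) (Sum.inl (bosonOfIdx ⟨k, h⟩).1)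
      (tauB (bosonOfIdx ⟨k, h⟩)) (degB (bosonOfIdx ⟨k, h⟩)) (top (bosonOfIdx ⟨k, h⟩)) z)
  else 1

def Ak (z1 z2 : F) (k : ℕ) : Spin r → Spin r → F :=
  Afun t z1 z2 ((k % r : ℕ) : ℤ) ((r : ℤ) - 1 - ((k / r : ℕ) : ℤ))

theorem expo_wrap (b : ℤ) (x y : Spin r) : expo (r : ℤ) b x y = expo 0 (b - 1) x y := by
  rcases x with p | p <;> rcases y with q | q <;> have := p.2 <;> have := q.2 <;>
    simp [expo] <;> split_ifs <;> omega

theorem expo_last (x y : Spin r) : expo 0 (-1) x y = expo 0 ((r : ℤ) - 1) x y := by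
  rcases x with p | p <;> rcases y with q | q <;> have := p.2 <;> have := q.2 <;>
    simp [expo] <;> (try split_ifs) <;> omega

theorem chain {z : Fin r → F} {a b : Fin r} (hab : a.val + 1 = b.val) (ht : t ≠ 0) (ht1 : 1 - t ≠ 0)
    (hz1 : z a ≠ 0) (hz2 : z b ≠ 0) (top : Fin r × Fin r → ℕ) (n : ℕ) (hn : n ≤ r * r) :
    Rmat a b (Ak t (z a) (z b) 0) (Bfun t (z a) (z b)) * Qprod (Cmat t top z) n =
    Qprod (Cmat t top (z ∘ Equiv.swap a b)) n * Rmat a b (Ak t (z a) (z b) n) (Bfun t (z a) (z b)) := by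
  induction n with
  | zero => simp [Qprod]
  | succ n ih =>
    have hlt : n < r * r := hn
    have hr : 0 < r := by
      rcases Nat.eq_zero_or_pos r with h | h
      · subst h; simp at hlt
      · exact h
    have hd : n / r < r := Nat.div_lt_of_lt_mul hlt
    simp only [Qprod]
    rw [← mul_assoc, ih hlt.le, mul_assoc, mul_assoc]
    congr 1
    have Y := colYB z hab ht ht1 hz1 hz2 (concreteYB (t := t) hz1 hz2 (bosonOfIdx ⟨n, hlt⟩))
      (top (bosonOfIdx ⟨n, hlt⟩))
    have e1 : Afun (r := r) t (z a) (z b) (((bosonOfIdx ⟨n, hlt⟩).1.val : ℕ) : ℤ)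
        (((bosonOfIdx ⟨n, hlt⟩).2.val : ℕ) : ℤ) = Ak t (z a) (z b) n := by
      unfold Ak bosonOfIdx
      congr 1
      simp only
      omega
    have e2 : Afun (r := r) t (z a) (z b) (((bosonOfIdx ⟨n, hlt⟩).1.val : ℕ) + 1 : ℤ)
        (((bosonOfIdx ⟨n, hlt⟩).2.val : ℕ) : ℤ) = Ak t (z a) (z b) (n + 1) := by
      have hb2 : (((bosonOfIdx ⟨n, hlt⟩).2.val : ℕ) : ℤ) = (r : ℤ) - 1 - ((n / r : ℕ) : ℤ) := by
        unfold bosonOfIdx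
        simp only
        omega
      have hb1 : (bosonOfIdx ⟨n, hlt⟩).1.val = n % r := rfl
      rw [hb1, hb2]
      unfold Ak
      have hm : n % r < r := Nat.mod_lt _ hr
      have hdm := Nat.div_add_mod n r
      by_cases hc : n % r + 1 = r
      · have q1 : (n + 1) / r = n / r + 1 := by
          have : n + 1 = r * (n / r + 1) := by rw [mul_add, mul_one]; omega
          rw [this, Nat.mul_div_cancel_left _ hr]
        have q2 : (n + 1) % r = 0 := by
          have : n + 1 = r * (n / r + 1) := by rw [mul_add, mul_one]; omega
          rw [this, Nat.mul_mod_right]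
        have q3 : ((n % r : ℕ) : ℤ) + 1 = r := by exact_mod_cast hc
        rw [q1, q2, q3]
        funext x y
        simp only [Afun, expo_wrap]
        congr 3
        push_cast; ring
      · have q1 : (n + 1) / r = n / r := by
          rw [Nat.div_eq_iff hr, mul_comm]; omega
        have q2 : (n + 1) % r = n % r + 1 := by
          have := Nat.div_add_mod (n + 1) r
          rw [q1] at this
          omega
        rw [q1, q2]; push_cast; rfl
    rw [e1, e2] at Y
    simp only [Cmat, hlt, dif_pos]
    exact Y

theorem Ak_last (z1 z2 : F) : Ak (r := r) t z1 z2 (r * r) = Ak t z1 z2 0 := by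
  rcases Nat.eq_zero_or_pos r with h | h
  · subst h; funext x; exact (x.elim Fin.elim0 Fin.elim0)
  funext x y
  simp only [Ak, Nat.mul_mod_right, Nat.mul_div_cancel_left _ h, Afun, Nat.zero_mod, Nat.zero_div]
  congr 2
  have := expo_last x y
  simp only [Nat.cast_zero, sub_zero]
  rw [← this]
  congr 1; ring

/-- matrix of a full column -/
def CM (top : ℕ → Fin r × Fin r → ℕ) (z : Fin r → F) (j : ℕ) :
    Matrix (Fin r → Spin r) (Fin r → Spin r) F := Qprod (Cmat t (top j) z) (r * r)

/-- matrix of the grid with n columns -/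
def Pmat (top : ℕ → Fin r × Fin r → ℕ) (z : Fin r → F) : ℕ →
    Matrix (Fin r → Spin r) (Fin r → Spin r) F
  | 0 => 1
  | n + 1 => CM t top z n * Pmat top z n

theorem fullYB {z : Fin r → F} {a b : Fin r} (hab : a.val + 1 = b.val) (ht : t ≠ 0) (ht1 : 1 - t ≠ 0)
    (hz1 : z a ≠ 0) (hz2 : z b ≠ 0) (top : ℕ → Fin r × Fin r → ℕ) (n : ℕ) :
    Rmat a b (Ak t (z a) (z b) 0) (Bfun t (z a) (z b)) * Pmat t top z n =
    Pmat t top (z ∘ Equiv.swap a b) n * Rmat a b (Ak t (z a) (z b) 0) (Bfun t (z a) (z b)) := by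
  induction n with
  | zero => simp [Pmat]
  | succ n ih =>
    have := chain t hab ht ht1 hz1 hz2 (top n) (r * r) le_rfl
    rw [Ak_last] at this
    simp only [Pmat]
    rw [← mul_assoc, CM, this, mul_assoc, ih, ← mul_assoc]
    rfl

theorem Pmat_eq (top : ℕ → Fin r × Fin r → ℕ) (z : Fin r → F) (n : ℕ) :
    Pmat t top z n = (Qprod (fun j => (CM t top z j).transpose) n).transpose := by
  induction n with
  | zero => simp [Pmat, Qprod]
  | succ n ih => simp [Pmat, Qprod, Matrix.transpose_mul, ih]

theorem Pmat_apply (top : ℕ → Fin r × Fin r → ℕ) (z : Fin r → F) (n : ℕ) (x y : Fin r → Spin r) :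
    Pmat t top z n x y = ∑ h : Fin (n + 1) → Fin r → Spin r,
      if h 0 = y ∧ h (Fin.last n) = x then
      ∏ j : Fin n, CM t top z j (h j.succ) (h j.castSucc) else 0 := by
  rw [Pmat_eq, Matrix.transpose_apply, Qprod_apply]
  rfl

end Chain


section ColState
variable {F : Type*} [Field F] {r : ℕ}

theorem boson_surj : Function.Surjective (bosonOfIdx (r := r)) := by
  rintro ⟨a, b⟩
  have ha := a.2
  have hb := b.2
  have hr : 0 < r := by omega
  have h1 : (r - 1 - b.val) * r + a.val < r * r := by
    have : (r - 1 - b.val) * r ≤ (r - 1) * r := Nat.mul_le_mul_right _ (by omega)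
    have h2 : (r - 1) * r + r = r * r := by
      obtain ⟨s, rfl⟩ : ∃ s, r = s + 1 := ⟨r - 1, by omega⟩
      simp; ring
    omega
  refine ⟨⟨(r - 1 - b.val) * r + a.val, h1⟩, ?_⟩
  have e1 : ((r - 1 - b.val) * r + a.val) % r = a.val := by
    rw [add_comm, Nat.add_mul_mod_self_right, Nat.mod_eq_of_lt ha]
  have e2 : ((r - 1 - b.val) * r + a.val) / r = r - 1 - b.val := by
    rw [mul_comm, Nat.mul_add_div hr, Nat.div_eq_of_lt ha, add_zero]
  unfold bosonOfIdx
  ext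
  · simpa using e1
  · simp only [e2]; omega

theorem boson_bij : Function.Bijective (bosonOfIdx (r := r)) := by
  rw [Fintype.bijective_iff_surjective_and_card]
  exact ⟨boson_surj, by simp⟩

theorem next_of_step {m m' : Fin r × Fin r → ℕ} {ab : Fin r × Fin r} {x y : Spin r}
    (h : StepOK m m' ab x y) : nextSpin m m' ab x = y := by
  unfold nextSpin
  rcases h with ⟨h1, h2⟩ | ⟨h1, h2, h3⟩ | ⟨h1, h2, h3⟩
  · rw [if_neg (by omega), if_neg (by omega), h1]
  · rw [if_pos h3, h2]
  · rw [if_neg (by omega), if_pos h3, h2]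

theorem path_unique {m m' : Fin r × Fin r → ℕ} {l : Spin r} (x : Fin (r * r + 1) → Spin r)
    (h0 : x 0 = l) (h : ∀ k : Fin (r * r), StepOK m m' (bosonOfIdx k) (x k.castSucc) (x k.succ))
    (k : Fin (r * r + 1)) : pathSpin m m' l k.val = x k := by
  induction k using Fin.induction with
  | zero => simp [pathSpin, h0]
  | succ k ih =>
    simp only [Fin.val_succ, pathSpin, k.2, dif_pos]
    simp only [Fin.val_castSucc] at ih
    rw [ih]
    exact next_of_step (h k)

theorem ind_of_step {m m' : Fin r × Fin r → ℕ} {ab : Fin r × Fin r} {x y : Spin r}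
    (h : StepOK m m' ab x y) :
    (m' ab : ℤ) = m ab + (ind (Sum.inr ab.2 : Spin r) y - ind (Sum.inr ab.2 : Spin r) x) := by
  rcases h with ⟨h1, h2⟩ | ⟨h1, h2, h3⟩ | ⟨h1, h2, h3⟩
  · rw [h1, h2]; ring
  · rw [h1, h2]; simp [ind]; omega
  · rw [h1, h2]; simp [ind]; omega

noncomputable def Phi (t : F) (z : Fin r → F) : PolyR r →+* F :=
  MvPolynomial.eval₂Hom (Int.castRingHom F) fun o => o.elim t z

theorem Phi_t (t : F) (z : Fin r → F) : Phi t z (tP r) = t := by simp [Phi, tP]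
theorem Phi_z (t : F) (z : Fin r → F) (i : Fin r) : Phi t z (zP i) = z i := by simp [Phi, zP]

theorem wt_of_step {t : F} (ht1 : 1 - t ≠ 0) (z : Fin r → F) (i : Fin r)
    {m m' : Fin r × Fin r → ℕ} {ab : Fin r × Fin r} {x y : Spin r}
    (h : StepOK m m' ab x y) :
    Phi t z (stepWeight (zP i) (m ab) (m' ab) ab x) =
    wt t (Sum.inr ab.2 : Spin r) (Sum.inl ab.1) (tauB ab) (degB ab) (z i) (t ^ (m ab : ℤ)) x y := by
  unfold stepWeight
  rcases h with ⟨h1, h2⟩ | ⟨h1, h2, h3⟩ | ⟨h1, h2, h3⟩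
  · rw [if_neg (by omega), if_neg (by omega), h1, h2, min_self]
    unfold wt passWeight
    rcases x with e | e
    · simp only [if_true, reduceCtorEq, if_false, Sum.inl.injEq, tauB, degB]
      split_ifs <;> simp_all [Phi_t, Phi_z] <;> order
    · simp only [if_true, reduceCtorEq, if_false, Sum.inr.injEq, tauB, degB]
      split_ifs <;> simp_all [Phi_t, Phi_z] <;> order
  · rw [if_pos h3, h1, h2, h3]
    have : min (m' ab + 1) (m' ab) = m' ab := by omega
    rw [this]
    simp only [wt, reduceCtorEq, if_false, and_self, if_true, map_sum, map_pow, Phi_t]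
    rw [eq_div_iff ht1, zpow_natCast]
    exact geom_sum_mul_neg t _
  · rw [if_neg (by omega), if_pos h3, h1, h2]
    simp [wt, Phi_t, Phi_z]

structure ColState (top : Fin r × Fin r → ℕ) (x y : Fin r → Spin r)
    (m : Fin (r + 1) → Fin r × Fin r → ℕ) : Prop where
  adm : ∀ i : Fin r, AdmissibleVertex (x i) (m i.castSucc) (y i) (m i.succ)
  top : m 0 = top
  bot : m (Fin.last r) = 0

def pathOf (x : Fin r → Spin r) (m : Fin (r + 1) → Fin r × Fin r → ℕ) :
    Fin (r * r + 1) → Fin r → Spin r :=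
  fun k i => pathSpin (m i.castSucc) (m i.succ) (x i) k.val

theorem ColState.step {top : Fin r × Fin r → ℕ} {x y : Fin r → Spin r}
    {m : Fin (r + 1) → Fin r × Fin r → ℕ} (h : ColState top x y m) (k : Fin (r * r)) (i : Fin r) :
    StepOK (m i.castSucc) (m i.succ) (bosonOfIdx k) (pathOf x m k.castSucc i)
      (pathOf x m k.succ i) := by
  obtain ⟨p, h0, h1, h2⟩ := h.adm i
  have := path_unique p h0 h2
  unfold pathOf
  rw [this, this]
  exact h2 k

theorem ColState.first {top : Fin r × Fin r → ℕ} {x y : Fin r → Spin r}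
    {m : Fin (r + 1) → Fin r × Fin r → ℕ} (_h : ColState top x y m) : pathOf x m 0 = x := by
  funext i; simp [pathOf, pathSpin]

theorem ColState.last {top : Fin r × Fin r → ℕ} {x y : Fin r → Spin r}
    {m : Fin (r + 1) → Fin r × Fin r → ℕ} (h : ColState top x y m) :
    pathOf x m (Fin.last _) = y := by
  funext i
  obtain ⟨p, h0, h1, h2⟩ := h.adm i
  have := path_unique p h0 h2
  unfold pathOf
  rw [this, h1]

theorem ColState.colM_eq {top : Fin r × Fin r → ℕ} {x y : Fin r → Spin r}
    {m : Fin (r + 1) → Fin r × Fin r → ℕ} (h : ColState top x y m) (k : Fin (r * r))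
    (i : Fin (r + 1)) :
    colM (top (bosonOfIdx k) : ℤ) (Sum.inr (bosonOfIdx k).2 : Spin r)
      (pathOf x m k.castSucc) (pathOf x m k.succ) i.val = (m i (bosonOfIdx k) : ℤ) := by
  induction i using Fin.induction with
  | zero => simp [colM, h.top]
  | succ i ih =>
    rw [Fin.val_succ, colM_succ, ind_of_step (h.step k i), ← ih]
    rfl

theorem colState_injOn (top : Fin r × Fin r → ℕ) (x y : Fin r → Spin r) :
    Set.InjOn (pathOf x) {m | ColState top x y m} := by
  intro m hm m' hm' he
  funext i ab
  obtain ⟨k, rfl⟩ := boson_surj ab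
  have h1 := hm.colM_eq k i
  have h2 := hm'.colM_eq k i
  rw [he, h2] at h1
  exact_mod_cast h1.symm

theorem colState_finite (top : Fin r × Fin r → ℕ) (x y : Fin r → Spin r) :
    {m | ColState top x y m}.Finite :=
  Set.Finite.of_injOn (t := Set.univ) (fun _ _ => Set.mem_univ _) (colState_injOn top x y)
    Set.finite_univ

noncomputable def colStates (top : Fin r × Fin r → ℕ) (x y : Fin r → Spin r) :
    Finset (Fin (r + 1) → Fin r × Fin r → ℕ) := (colState_finite top x y).toFinset

theorem wt_nonneg {t : F} {ab : Fin r × Fin r} {z : F} {M : ℤ} {x y : Spin r} (hM : 0 ≤ M)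
    (h : wt t (Sum.inr ab.2 : Spin r) (Sum.inl ab.1) (tauB ab) (degB ab) z (t ^ M) x y ≠ 0) :
    (x = y ∨ (x = Sum.inr ab.2 ∧ y = Sum.inl ab.1 ∧ 1 ≤ M) ∨ (x = Sum.inl ab.1 ∧ y = Sum.inr ab.2)) := by
  by_contra hc
  push Not at hc
  obtain ⟨h1, h2, h3⟩ := hc
  apply h
  unfold wt
  rw [if_neg h1]
  by_cases h4 : x = Sum.inr ab.2 ∧ y = Sum.inl ab.1
  · have := h2 h4.1 h4.2
    have : M = 0 := by omega
    rw [if_pos h4, this]; simp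
  · rw [if_neg h4, if_neg]
    rintro ⟨h5, h6⟩
    exact h3 h5 h6

theorem col_sum {t : F} (ht1 : 1 - t ≠ 0) (z : Fin r → F) (top : Fin r × Fin r → ℕ)
    (x y : Fin r → Spin r) :
    ∑ m ∈ colStates top x y, Phi t z (∏ i : Fin r, vertexWeight (zP i) (x i) (m i.castSucc) (m i.succ))
      = Qprod (Cmat t top z) (r * r) x y := by
  rw [Qprod_apply]
  apply Finset.sum_of_injOn (pathOf x)
  · intro m hm m' hm'
    apply colState_injOn top x y
    · simpa [colStates] using hm
    · simpa [colStates] using hm'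
  · intro m hm; simp
  · intro q _ hq
    by_contra hne
    apply hq
    have hends : q 0 = x ∧ q (Fin.last _) = y := by
      by_contra hc
      rw [if_neg hc] at hne
      exact hne rfl
    rw [if_pos hends] at hne
    replace hne := Finset.prod_ne_zero_iff.1 hne
    set e := Equiv.ofBijective _ (boson_bij (r := r)) with he
    let M : Fin (r * r) → ℕ → ℤ := fun k i => colM (top (bosonOfIdx k) : ℤ)
      (Sum.inr (bosonOfIdx k).2 : Spin r) (q k.castSucc) (q k.succ) i
    have hk : ∀ k : Fin (r * r), M k r = 0 ∧ ∀ i : Fin r,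
        wt t (Sum.inr (bosonOfIdx k).2 : Spin r) (Sum.inl (bosonOfIdx k).1) (tauB (bosonOfIdx k))
          (degB (bosonOfIdx k)) (z i) (t ^ M k i) (q k.castSucc i) (q k.succ i) ≠ 0 := by
      intro k
      have := hne k (Finset.mem_univ _)
      simp only [Cmat, k.2, dif_pos, Matrix.of_apply, colW] at this
      by_cases hc : M k r = 0
      · refine ⟨hc, ?_⟩
        rw [if_pos hc, Finset.prod_ne_zero_iff] at this
        exact fun i => this i (Finset.mem_univ _)
      · rw [if_neg hc] at this
        exact absurd rfl this
    have hsucc : ∀ (k : Fin (r * r)) (i : Fin r), M k (i.val + 1) = M k i +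
        (ind (Sum.inr (bosonOfIdx k).2 : Spin r) (q k.succ i) -
          ind (Sum.inr (bosonOfIdx k).2 : Spin r) (q k.castSucc i)) := by
      intro k i
      exact colM_succ _ _ _ _ i
    have hpos : ∀ (k : Fin (r * r)) (i : Fin (r + 1)), 0 ≤ M k i.val := by
      intro k i
      induction i using Fin.induction with
      | zero => simp [M, colM]
      | succ i ih =>
        rw [Fin.val_succ, hsucc]
        simp only [Fin.val_castSucc] at ih
        rcases wt_nonneg ih ((hk k).2 i) with h | ⟨h1, h2, h3⟩ | ⟨h1, h2⟩
        · rw [h]; simpa using ih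
        · rw [h1, h2]; simp [ind]; omega
        · rw [h1, h2]; simp [ind]; omega
    let m : Fin (r + 1) → Fin r × Fin r → ℕ := fun i ab => (M (e.symm ab) i.val).toNat
    have hm : ∀ i k, (m i (bosonOfIdx k) : ℤ) = M k i.val := by
      intro i k
      have : e.symm (bosonOfIdx k) = k := e.symm_apply_apply k
      simp only [m, this]
      exact Int.toNat_of_nonneg (hpos k i)
    have hstep : ∀ (i : Fin r) (k : Fin (r * r)),
        StepOK (m i.castSucc) (m i.succ) (bosonOfIdx k) (q k.castSucc i) (q k.succ i) := by
      intro i k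
      have a1 := hm i.castSucc k
      have a2 := hm i.succ k
      rw [Fin.val_succ, hsucc] at a2
      simp only [Fin.val_castSucc] at a1
      have h0 := hpos k i.castSucc
      rw [Fin.val_castSucc] at h0
      rcases wt_nonneg h0 ((hk k).2 i) with h | ⟨h1, h2, h3⟩ | ⟨h1, h2⟩
      · left
        rw [h] at a2 ⊢
        refine ⟨rfl, ?_⟩
        omega
      · right; left
        rw [h1, h2] at a2
        simp [ind] at a2
        exact ⟨h1, h2, by omega⟩
      · right; right
        rw [h1, h2] at a2
        simp [ind] at a2
        exact ⟨h1, h2, by omega⟩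
    refine ⟨m, ?_, ?_⟩
    · simp only [colStates, Set.Finite.coe_toFinset, Set.mem_ofPred_eq]
      refine ⟨fun i => ⟨fun k => q k i, congrFun hends.1 i, congrFun hends.2 i, hstep i⟩, ?_, ?_⟩
      · funext ab
        obtain ⟨k, rfl⟩ := boson_surj ab
        have := hm 0 k
        simp [M, colM] at this
        exact this
      · funext ab
        obtain ⟨k, rfl⟩ := boson_surj ab
        have := hm (Fin.last r) k
        rw [Fin.val_last, (hk k).1] at this
        exact_mod_cast this
    · funext k i
      exact path_unique (fun k => q k i) (congrFun hends.1 i) (hstep i) k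
  · intro m hm
    have h : ColState top x y m := by simpa [colStates] using hm
    rw [if_pos ⟨h.first, h.last⟩, map_prod]
    simp only [vertexWeight, map_prod]
    rw [Finset.prod_comm]
    apply Finset.prod_congr rfl
    intro k _
    simp only [Cmat, k.2, dif_pos, Matrix.of_apply, colW]
    rw [if_pos]
    · apply Finset.prod_congr rfl
      intro i _
      have h1 := h.colM_eq k i.castSucc
      rw [Fin.val_castSucc] at h1
      rw [h1]
      exact wt_of_step ht1 z i (h.step k i)
    · have h1 := h.colM_eq k (Fin.last r)
      rw [Fin.val_last] at h1
      rw [h1, h.bot]; rfl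

end ColState


section Final
variable {F : Type*} [Field F] {r : ℕ}

def topF (lam : Fin r → ℕ) (w3 w4 : Equiv.Perm (Fin r)) (j : ℕ) (ab : Fin r × Fin r) : ℕ :=
  (Finset.univ.filter fun i : Fin r =>
            lam i = j ∧ w3⁻¹ i = ab.1 ∧ w4⁻¹ (Fin.rev i) = ab.2).card

def fillEquiv (r N : ℕ) : (Σ _ : (Fin (N + 1) → Fin r → Spin r),
    (Fin N → Fin (r + 1) → Fin r × Fin r → ℕ)) ≃ Filling r N where
  toFun p := ⟨fun i j => p.2 j i, fun i j => p.1 j i⟩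
  invFun f := ⟨fun j i => f.h i j, fun j i => f.m i j⟩
  left_inv _ := rfl
  right_inv _ := rfl

theorem inSystem_iff {N : ℕ} (lam : Fin r → ℕ) (w1 w2 w3 w4 : Equiv.Perm (Fin r))
    (h : Fin (N + 1) → Fin r → Spin r) (m : Fin N → Fin (r + 1) → Fin r × Fin r → ℕ) :
    InSystem lam w1 w2 w3 w4 (fillEquiv r N ⟨h, m⟩) ↔
      ((h 0 = fun i => Sum.inl (w1⁻¹ i)) ∧ (h (Fin.last N) = fun i => Sum.inr (w2⁻¹ i))) ∧
      ∀ j, m j ∈ colStates (topF lam w3 w4 j.val) (h j.succ) (h j.castSucc) := by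
  simp only [colStates, Set.Finite.mem_toFinset, Set.mem_ofPred_eq]
  constructor
  · rintro ⟨h1, h2, h3, h4, h5⟩
    refine ⟨⟨funext h4, funext h5⟩, fun j => ⟨fun i => h1 i j, ?_, ?_⟩⟩
    · funext ab; exact h2 j ab.1 ab.2
    · funext ab; exact h3 j ab
  · rintro ⟨⟨h1, h2⟩, h3⟩
    refine ⟨fun i j => (h3 j).adm i, fun j a b => ?_, fun j ab => ?_, fun i => ?_, fun i => ?_⟩
    · exact congrFun (h3 j).top (a, b)
    · exact congrFun (h3 j).bot ab
    · exact congrFun h1 i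
    · exact congrFun h2 i

theorem partition_eq {t : F} (ht1 : 1 - t ≠ 0) (z : Fin r → F) (N : ℕ) (lam : Fin r → ℕ)
    (w1 w2 w3 w4 : Equiv.Perm (Fin r)) :
    Phi t z (partitionZ r N lam w1 w2 w3 w4) =
      Pmat t (topF lam w3 w4) z N (fun i => Sum.inr (w2⁻¹ i)) (fun i => Sum.inl (w1⁻¹ i)) := by
  classical
  unfold partitionZ
  rw [← finsum_comp_equiv (fillEquiv r N)]
  rw [finsum_eq_sum_of_support_subset (s := (Finset.univ.filter
      fun h : Fin (N + 1) → Fin r → Spin r =>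
      (h 0 = fun i => Sum.inl (w1⁻¹ i)) ∧ (h (Fin.last N) = fun i => Sum.inr (w2⁻¹ i))).sigma
      fun h => Fintype.piFinset fun j : Fin N =>
        colStates (topF lam w3 w4 j.val) (h j.succ) (h j.castSucc))]
  · rw [Finset.sum_sigma, map_sum, Pmat_apply, Finset.sum_filter]
    apply Finset.sum_congr rfl
    intro h _
    split_ifs with hh
    · simp only [CM, ← col_sum ht1]
      rw [Finset.prod_univ_sum, map_sum]
      apply Finset.sum_congr rfl
      intro m hm
      rw [Fintype.mem_piFinset] at hm
      rw [if_pos ((inSystem_iff lam w1 w2 w3 w4 h m).2 ⟨hh, hm⟩), ← map_prod]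
      congr 1
      unfold stateWeight
      rw [Finset.prod_comm]
      rfl
    · rfl
  · rintro ⟨h, m⟩ hs
    rw [Function.mem_support] at hs
    have : InSystem lam w1 w2 w3 w4 (fillEquiv r N ⟨h, m⟩) := by
      by_contra hc
      exact hs (if_neg hc)
    rw [inSystem_iff] at this
    simpa [Fintype.mem_piFinset] using this

theorem inv_mono {w : Equiv.Perm (Fin r)} {a b : Fin r} (hab : a.val + 1 = b.val)
    (h : w⁻¹ a < w⁻¹ b) : invCount w ≤ invCount (Equiv.swap a b * w) := by
  unfold invCount
  apply Finset.card_le_card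
  intro pq hp
  replace hp := (Finset.mem_filter.1 hp).2
  obtain ⟨p, q⟩ := pq
  refine Finset.mem_filter.2 ⟨Finset.mem_univ _, hp.1, ?_⟩
  simp only [Equiv.Perm.mul_apply] at hp ⊢
  have hn : ¬ (w q = a ∧ w p = b) := by
    rintro ⟨h1, h2⟩
    rw [← h1, ← h2] at h
    have h3 : q < p := by simpa using h
    exact absurd h3 (not_lt.2 hp.1.le)
  have h2 := hp.2
  rw [Equiv.swap_apply_def, Equiv.swap_apply_def]
  rw [Fin.lt_def] at h2 ⊢
  simp only [Fin.ext_iff] at hn ⊢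
  split_ifs <;> omega

theorem inv_lt1 {w : Equiv.Perm (Fin r)} {a b : Fin r} (hab : a.val + 1 = b.val)
    (h : invCount (Equiv.swap a b * w) < invCount w) : w⁻¹ b < w⁻¹ a := by
  by_contra hc
  have hne : w⁻¹ a ≠ w⁻¹ b := by
    intro h; have := w⁻¹.injective h; rw [this] at hab; omega
  have := inv_mono hab (lt_of_le_of_ne (not_lt.1 hc) hne)
  omega

theorem inv_lt2 {w : Equiv.Perm (Fin r)} {a b : Fin r} (hab : a.val + 1 = b.val)
    (h : invCount (Equiv.swap a b * w) > invCount w) : w⁻¹ a < w⁻¹ b := by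
  have := inv_lt1 (w := Equiv.swap a b * w) hab (by rw [← mul_assoc]; simpa using h)
  simpa [mul_inv_rev] using this

theorem mainF {t : F} (ht : t ≠ 0) (ht1 : 1 - t ≠ 0) (z : Fin r → F) (N : ℕ) (lam : Fin r → ℕ)
    (w1 w2 w3 w4 : Equiv.Perm (Fin r)) {a b : Fin r} (hab : a.val + 1 = b.val)
    (hz1 : z a ≠ 0) (hz2 : z b ≠ 0)
    (h1 : w1⁻¹ b < w1⁻¹ a) (h2 : w2⁻¹ a < w2⁻¹ b) :
    (1 - t) * z b * Phi t z (partitionZ r N lam w1 w2 w3 w4)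
      + t * (z a - z b) * Phi t z (partitionZ r N lam w1 (Equiv.swap a b * w2) w3 w4) =
    (1 - t) * z a * Phi t (z ∘ Equiv.swap a b) (partitionZ r N lam w1 w2 w3 w4)
      + (z a - z b) * Phi t (z ∘ Equiv.swap a b)
        (partitionZ r N lam (Equiv.swap a b * w1) w2 w3 w4) := by
  have Y := congrFun (congrFun (fullYB t hab ht ht1 hz1 hz2 (topF lam w3 w4) N)
    (fun i => Sum.inr (w2⁻¹ i))) (fun i => Sum.inl (w1⁻¹ i))
  rw [Rmat_mul, mul_Rmat] at Y
  have e1 : ((fun i => Sum.inr (w2⁻¹ i)) ∘ Equiv.swap a b : Fin r → Spin r) =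
      fun i => Sum.inr ((Equiv.swap a b * w2)⁻¹ i) := by
    funext i; simp [mul_inv_rev]
  have e2 : ((fun i => Sum.inl (w1⁻¹ i)) ∘ Equiv.swap a b : Fin r → Spin r) =
      fun i => Sum.inl ((Equiv.swap a b * w1)⁻¹ i) := by
    funext i; simp [mul_inv_rev]
  rw [e1, e2] at Y
  simp only [← partition_eq ht1] at Y
  have hr : 0 < r := a.pos
  have q1 : Ak (r := r) t (z a) (z b) 0 (Sum.inr (w2⁻¹ a)) (Sum.inr (w2⁻¹ b)) = (1 - t) * z b := by
    have p1 := (w2⁻¹ a).2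
    have p2 := (w2⁻¹ b).2
    have : expo (r := r) ((0 % r : ℕ) : ℤ) ((r : ℤ) - 1 - ((0 / r : ℕ) : ℤ)) (Sum.inr (w2⁻¹ a)) (Sum.inr (w2⁻¹ b)) = 0 := by
      simp only [expo, Nat.zero_mod, Nat.zero_div, Nat.cast_zero, lt_irrefl, if_false, h2.not_gt]
      rw [if_neg (by omega), if_neg (by omega)]; rfl
    rw [Ak, Afun, this, if_neg (by simpa using h2.ne), Aval_zero]
  have q2 : Ak (r := r) t (z a) (z b) 0 (Sum.inl (w1⁻¹ a)) (Sum.inl (w1⁻¹ b)) = (1 - t) * z a := by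
    have : expo (r := r) ((0 % r : ℕ) : ℤ) ((r : ℤ) - 1 - ((0 / r : ℕ) : ℤ)) (Sum.inl (w1⁻¹ a)) (Sum.inl (w1⁻¹ b)) = 1 := by
      simp only [expo, Nat.zero_mod, Nat.cast_zero, h1, if_true]
      rw [if_neg (by omega), if_neg (by omega)]; rfl
    rw [Ak, Afun, this, if_neg (by simpa using h1.ne'), Aval_one]
  have q3 : Bfun (r := r) t (z a) (z b) (Sum.inr (w2⁻¹ a)) (Sum.inr (w2⁻¹ b)) = t * (z a - z b) := by
    rw [Bfun, if_neg (by simpa using h2.ne), Bc, if_pos h2]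
  have q4 : Bfun (r := r) t (z a) (z b) (Sum.inl (w1⁻¹ b)) (Sum.inl (w1⁻¹ a)) = (z a - z b) := by
    rw [Bfun, if_neg (by simpa using h1.ne), Bc, if_pos h1, one_mul]
  rw [q1, q2, q3, q4] at Y
  linear_combination Y

theorem toFF_eq (r : ℕ) : toFF r = Phi (tF r) (zF (r := r)) := rfl

theorem sigma_zF {r : ℕ} (a b i : Fin r) : sigmaF a b (zF i) = zF (Equiv.swap a b i) := by
  unfold sigmaF zF
  rw [IsFractionRing.ringEquivOfRingEquiv_algebraMap]
  simp

theorem sigma_tF {r : ℕ} (a b : Fin r) : sigmaF a b (tF r) = tF r := by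
  unfold sigmaF tF
  rw [IsFractionRing.ringEquivOfRingEquiv_algebraMap]
  simp

theorem sigma_toFF {r : ℕ} (a b : Fin r) (p : PolyR r) :
    sigmaF a b (toFF r p) = Phi (tF r) (zF ∘ Equiv.swap a b) p := by
  have : (sigmaF a b : FFld r →+* FFld r).comp (toFF r) = Phi (tF r) (zF ∘ Equiv.swap a b) := by
    apply MvPolynomial.ringHom_ext
    · intro n; simp [toFF, Phi]
    · rintro (_ | i)
      · simp [toFF, Phi, sigma_tF]
      · simp [toFF, Phi, sigma_zF]
  exact congrArg (fun f => f p) this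

theorem algMap_inj (r : ℕ) : Function.Injective (algebraMap (MvPolynomial (Fin r) Kt) (FFld r)) :=
  IsFractionRing.injective _ _

theorem zF_ne {r : ℕ} (i : Fin r) : zF i ≠ 0 := by
  unfold zF
  rw [Ne, map_eq_zero_iff _ (algMap_inj r)]
  exact MvPolynomial.X_ne_zero i

theorem zF_sub_ne {r : ℕ} {i j : Fin r} (h : i ≠ j) : zF i - zF j ≠ 0 := by
  rw [sub_ne_zero]
  intro he
  exact h (MvPolynomial.X_injective (algMap_inj r he))

theorem tF_ne (r : ℕ) : tF r ≠ 0 := by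
  unfold tF
  rw [Ne, map_eq_zero_iff _ (algMap_inj r), MvPolynomial.C_eq_zero]
  exact RatFunc.X_ne_zero

theorem ratX_ne_one : (RatFunc.X : Kt) ≠ 1 := by
  intro h
  rw [← RatFunc.algebraMap_X, ← map_one (algebraMap (Polynomial ℚ) (RatFunc ℚ))] at h
  exact Polynomial.X_ne_C (1 : ℚ) (by simpa using RatFunc.algebraMap_injective ℚ h)

theorem tF_ne_one (r : ℕ) : 1 - tF r ≠ 0 := by
  rw [sub_ne_zero]
  intro h
  unfold tF at h
  rw [← map_one (algebraMap (MvPolynomial (Fin r) Kt) (FFld r))] at h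
  have h' := algMap_inj r h
  rw [← MvPolynomial.C_1] at h'
  exact ratX_ne_one (MvPolynomial.C_injective _ _ h').symm

end Final

theorem stmt12 (r N : ℕ) (hr : 2 ≤ r) (hN : 1 ≤ N)
    (lam : Fin r → ℕ)
    (hpart : ∀ i j : Fin r, i ≤ j → lam j ≤ lam i)
    (hlam1 : lam ⟨0, by omega⟩ ≤ N - 1)
    (w3 w4 : Equiv.Perm (Fin r))
    (w1 w2 : Equiv.Perm (Fin r))
    (i : ℕ) (h1 : 1 ≤ i) (h2 : i ≤ r - 1) :
    let a : Fin r := ⟨i - 1, by omega⟩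
    let b : Fin r := ⟨i, by omega⟩
    let s : Equiv.Perm (Fin r) := Equiv.swap a b
    let Z : Equiv.Perm (Fin r) → Equiv.Perm (Fin r) → FFld r := fun u v =>
      toFF r (partitionZ r N lam u v w3 w4)
    invCount (s * w1) < invCount w1 →
    invCount (s * w2) > invCount w2 →
    (1 - tF r) * DF3 a b (Z w1 w2) = sigmaF a b (Z (s * w1) w2) - tF r * Z w1 (s * w2) := by
  intro a b s Z hw1 hw2
  have hab : a.val + 1 = b.val := by simp only [a, b]; omega
  have hne : a ≠ b := by intro h; rw [h] at hab; omega
  have M := mainF (tF_ne r) (tF_ne_one r) zF N lam w1 w2 w3 w4 hab (zF_ne a) (zF_ne b)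
    (inv_lt1 hab hw1) (inv_lt2 hab hw2)
  rw [← sigma_toFF, ← sigma_toFF, ← toFF_eq] at M
  have hsub := zF_sub_ne hne
  unfold DF3
  simp only [Z, s]
  generalize toFF r (partitionZ r N lam w1 w2 w3 w4) = P at M ⊢
  generalize toFF r (partitionZ r N lam (Equiv.swap a b * w1) w2 w3 w4) = P1 at M ⊢
  generalize toFF r (partitionZ r N lam w1 (Equiv.swap a b * w2) w3 w4) = P2 at M ⊢
  generalize sigmaF a b P = sP at M ⊢
  generalize sigmaF a b P1 = sP1 at M ⊢
  apply mul_left_cancel₀ hsub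
  rw [← mul_assoc, mul_comm (zF a - zF b) (1 - tF r), mul_assoc, ← mul_assoc (zF a - zF b),
    mul_inv_cancel₀ hsub]
  linear_combination M
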